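/- There exist a matrix P ∈ GL(17, ℤ) and a 15×15 symmetric integer matrix K₁ such that Pᵀ M P equals the block-diagonal matrix U ⊕ K₁, where K₁ is negative definite with even diagonal entries and det K₁ = -18. (The Picard lattice of the family associated to U_{1,0} is isometric to U ⊕ K₁ with K₁ a negative-definite even lattice of rank 15 and discriminant -18.) -/

import Mathlib

open Matrix

def M : Matrix (Fin 17) (Fin 17) ℤ :=
  !![-2, 1, 0, 0, 0, 0, 0, 0, 0, 1, 0, 0, 0, 0, 0, 0, 0;
    1, -2, 0, 0, 0, 0, 0, 0, 0, 0, 0, 1, 0, 0, 0, 1, 0;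
    0, 0, -2, 0, 0, 0, 0, 1, 0, 0, 0, 0, 0, 0, 1, 0, 1;
    0, 0, 0, -2, 0, 0, 1, 1, 1, 0, 0, 0, 0, 0, 0, 0, 0;
    0, 0, 0, 0, -2, 0, 0, 0, 1, 0, 0, 0, 0, 0, 0, 0, 0;
    0, 0, 0, 0, 0, -2, 0, 0, 0, 0, 0, 0, 1, 1, 0, 0, 0;
    0, 0, 0, 1, 0, 0, -2, 0, 0, 0, 0, 0, 0, 0, 0, 0, 0;
    0, 0, 1, 1, 0, 0, 0, -2, 0, 0, 0, 0, 0, 0, 0, 0, 0;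
    0, 0, 0, 1, 1, 0, 0, 0, -2, 0, 0, 0, 0, 0, 0, 0, 0;
    1, 0, 0, 0, 0, 0, 0, 0, 0, -2, 1, 0, 0, 0, 0, 0, 0;
    0, 0, 0, 0, 0, 0, 0, 0, 0, 1, -2, 0, 0, 0, 0, 0, 0;
    0, 1, 0, 0, 0, 0, 0, 0, 0, 0, 0, -2, 1, 0, 0, 0, 0;
    0, 0, 0, 0, 0, 1, 0, 0, 0, 0, 0, 1, -2, 0, 0, 0, 0;
    0, 0, 0, 0, 0, 1, 0, 0, 0, 0, 0, 0, 0, -2, 1, 0, 0;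
    0, 0, 1, 0, 0, 0, 0, 0, 0, 0, 0, 0, 0, 1, -2, 0, 0;
    0, 1, 0, 0, 0, 0, 0, 0, 0, 0, 0, 0, 0, 0, 0, -2, 1;
    0, 0, 1, 0, 0, 0, 0, 0, 0, 0, 0, 0, 0, 0, 0, 1, -2]

def U2 : Matrix (Fin 2) (Fin 2) ℤ :=
  !![0, 1;
    1, 0]

/-- The first two columns span a hyperbolic plane containing the isotropic sum over the 9-cycle
of the graph of `M`; the others are a basis of its orthogonal complement. -/
def changeOfBasis : Matrix (Fin 17) (Fin 17) ℤ :=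
  !![0, 1, 0, 0, 0, 0, 0, 0, 0, 0, 0, 0, 0, 0, 0, -1, 0;
    1, 1, 0, -1, 0, 0, 0, 0, 0, 0, 0, 0, 0, 0, 0, -2, 0;
    1, 1, 0, -1, 0, 0, 0, 0, 0, 0, 0, 0, 0, 0, 0, -2, 1;
    0, 0, 0, 0, 0, 0, 0, 0, 0, 0, 0, 0, 0, 0, 1, 0, 0;
    0, 0, 0, 0, 0, 0, 0, 0, 0, 0, 0, 0, 1, 0, 0, 0, 0;
    1, 1, 0, -1, 0, 0, 1, 0, 0, 0, 0, 0, 0, 0, 0, -2, 0;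
    0, 0, 0, 0, 0, 0, 0, 0, 0, 0, 0, 1, 0, 0, 0, 0, 0;
    0, 0, 0, 0, 0, 0, 0, 0, 0, 0, 0, 0, 0, 0, 0, 1, 0;
    0, 0, 0, 0, 0, 0, 0, 0, 0, 0, 0, 0, 0, 1, 0, 0, 0;
    0, 0, 0, 1, 0, 0, 0, 0, 0, 0, 0, 0, 0, 0, 0, 0, 0;
    0, 0, 1, 0, 0, 0, 0, 0, 0, 0, 0, 0, 0, 0, 0, 0, 0;
    1, 1, 0, -1, 1, 0, 0, 0, 0, 0, 0, 0, 0, 0, 0, -2, 0;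
    1, 1, 0, -1, 0, 1, 0, 0, 0, 0, 0, 0, 0, 0, 0, -2, 0;
    1, 1, 0, -1, 0, 0, 0, 1, 0, 0, 0, 0, 0, 0, 0, -2, 0;
    1, 1, 0, -1, 0, 0, 0, 0, 1, 0, 0, 0, 0, 0, 0, -2, 0;
    1, 1, 0, -1, 0, 0, 0, 0, 0, 1, 0, 0, 0, 0, 0, -2, 0;
    1, 1, 0, -1, 0, 0, 0, 0, 0, 0, 1, 0, 0, 0, 0, -2, 0]

/-- The inverse of `changeOfBasis`. -/
def changeOfBasisInv : Matrix (Fin 17) (Fin 17) ℤ :=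
  !![-1, 1, 0, 0, 0, 0, 0, 1, 0, 1, 0, 0, 0, 0, 0, 0, 0;
    1, 0, 0, 0, 0, 0, 0, 1, 0, 0, 0, 0, 0, 0, 0, 0, 0;
    0, 0, 0, 0, 0, 0, 0, 0, 0, 0, 1, 0, 0, 0, 0, 0, 0;
    0, 0, 0, 0, 0, 0, 0, 0, 0, 1, 0, 0, 0, 0, 0, 0, 0;
    0, -1, 0, 0, 0, 0, 0, 0, 0, 0, 0, 1, 0, 0, 0, 0, 0;
    0, -1, 0, 0, 0, 0, 0, 0, 0, 0, 0, 0, 1, 0, 0, 0, 0;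
    0, -1, 0, 0, 0, 1, 0, 0, 0, 0, 0, 0, 0, 0, 0, 0, 0;
    0, -1, 0, 0, 0, 0, 0, 0, 0, 0, 0, 0, 0, 1, 0, 0, 0;
    0, -1, 0, 0, 0, 0, 0, 0, 0, 0, 0, 0, 0, 0, 1, 0, 0;
    0, -1, 0, 0, 0, 0, 0, 0, 0, 0, 0, 0, 0, 0, 0, 1, 0;
    0, -1, 0, 0, 0, 0, 0, 0, 0, 0, 0, 0, 0, 0, 0, 0, 1;
    0, 0, 0, 0, 0, 0, 1, 0, 0, 0, 0, 0, 0, 0, 0, 0, 0;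
    0, 0, 0, 0, 1, 0, 0, 0, 0, 0, 0, 0, 0, 0, 0, 0, 0;
    0, 0, 0, 0, 0, 0, 0, 0, 1, 0, 0, 0, 0, 0, 0, 0, 0;
    0, 0, 0, 1, 0, 0, 0, 0, 0, 0, 0, 0, 0, 0, 0, 0, 0;
    0, 0, 0, 0, 0, 0, 0, 1, 0, 0, 0, 0, 0, 0, 0, 0, 0;
    0, -1, 1, 0, 0, 0, 0, 0, 0, 0, 0, 0, 0, 0, 0, 0, 0]

/-- The parent function of the tree, rooted at `14`, that supports the off-diagonal entries of
`complementGram`. -/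
def treeParent : Fin 15 → Fin 15 :=
  ![1, 13, 3, 4, 5, 6, 14, 8, 14, 12, 11, 12, 13, 14, 14]

/-- The Gram matrix of the orthogonal complement of the hyperbolic plane. -/
def complementGram : Matrix (Fin 15) (Fin 15) ℤ :=
  Matrix.of fun i j ↦
    if i = j then (if i = 13 then -4 else -2)
    else if j = treeParent i then (if i = 1 then -1 else 1)
    else if i = treeParent j then (if j = 1 then -1 else 1)
    else 0

/-- The linear forms whose weighted squares sum to a multiple of `-complementGram`. -/
def squaresFactor : Matrix (Fin 15) (Fin 15) ℤ :=
  Matrix.of fun i j ↦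
    if i = j then ![2, 3, 2, 3, 4, 5, 6, 2, 3, 2, 2, 3, 5, 32, 1] i
    else if j = treeParent i then ![-1, 2, -1, -2, -3, -4, -5, -1, -2, -1, -1, -2, -6, -15, 0] i
    else 0

/-- The weights of the squares of the forms in `squaresFactor`. -/
def squaresWeight : Fin 15 → ℤ :=
  ![240, 80, 240, 80, 40, 24, 16, 240, 80, 240, 240, 80, 16, 1, 15]

/-- A matrix which is, up to a positive factor, minus a weighted sum of squares of independent
linear forms is negative definite. -/
theorem dotProduct_mulVec_neg_of_smul_eq {n : Type*} [Fintype n] [DecidableEq n]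
    {K L : Matrix n n ℤ} {d : n → ℤ} {c : ℤ} (hc : 0 < c) (hd : ∀ i, 0 < d i)
    (hL : L.det ≠ 0) (h : c • K = -(Lᵀ * diagonal d * L)) {v : n → ℤ} (hv : v ≠ 0) :
    v ⬝ᵥ (K *ᵥ v) < 0 := by
  have hw : L *ᵥ v ≠ 0 := fun h0 ↦ hv (eq_zero_of_mulVec_eq_zero hL h0)
  obtain ⟨k, hk⟩ := Function.ne_iff.mp hw
  have hsum : c * (v ⬝ᵥ (K *ᵥ v)) = -∑ i, d i * (L *ᵥ v) i ^ 2 := by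
    rw [← smul_eq_mul, ← dotProduct_smul, ← smul_mulVec, h, neg_mulVec, dotProduct_neg,
      ← mulVec_mulVec, ← mulVec_mulVec, dotProduct_mulVec, vecMul_transpose]
    simp only [dotProduct, mulVec_diagonal]
    congr 1
    exact Finset.sum_congr rfl fun i _ ↦ by ring
  have hpos : 0 < ∑ i, d i * (L *ᵥ v) i ^ 2 :=
    Finset.sum_pos' (fun i _ ↦ mul_nonneg (hd i).le (sq_nonneg _))
      ⟨k, Finset.mem_univ k, mul_pos (hd k) (sq_pos_of_ne_zero hk)⟩
  nlinarith

theorem complementGram_smul_eq :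
    (480 : ℤ) • complementGram = -(squaresFactorᵀ * diagonal squaresWeight * squaresFactor) := by
  decide +kernel

theorem squaresFactor_det : squaresFactor.det = 49766400 := by
  have h : ∀ i, ∀ j < i, squaresFactor i j = 0 := by
    simp only [squaresFactor, of_apply]
    decide +kernel
  rw [det_of_isUpperTriangular fun i j hij ↦ h i j hij]
  decide +kernel

theorem complementGram_det : complementGram.det = -18 := by
  have h := congrArg det complementGram_smul_eq
  rw [det_smul, det_neg, det_mul, det_mul, det_transpose, det_diagonal, squaresFactor_det,
    show ∏ i, squaresWeight i = 120231596497305600000000000 by decide +kernel,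
    Fintype.card_fin] at h
  norm_num at h
  linarith

theorem changeOfBasis_mul_inv : changeOfBasis * changeOfBasisInv = 1 := by
  decide +kernel

theorem changeOfBasis_gram :
    changeOfBasisᵀ * M * changeOfBasis =
      reindex finSumFinEquiv finSumFinEquiv (fromBlocks U2 0 0 complementGram) := by
  decide +kernel

theorem stmt_9 :
    ∃ (P : Matrix (Fin 17) (Fin 17) ℤ) (K : Matrix (Fin 15) (Fin 15) ℤ),
      (P.det = 1 ∨ P.det = -1) ∧
      K.IsSymm ∧
      (∀ v : Fin 15 → ℤ, v ≠ 0 → v ⬝ᵥ (K *ᵥ v) < 0) ∧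
      (∀ i, Even (K i i)) ∧
      K.det = -18 ∧
      Pᵀ * M * P = Matrix.reindex finSumFinEquiv finSumFinEquiv (Matrix.fromBlocks U2 0 0 K) := by
  refine ⟨changeOfBasis, complementGram, Int.isUnit_iff.mp ?_, ?_, fun v hv ↦ ?_, ?_,
    complementGram_det, changeOfBasis_gram⟩
  · exact (isUnit_iff_isUnit_det _).mp (IsUnit.of_mul_eq_one _ changeOfBasis_mul_inv)
  · unfold IsSymm; decide +kernel
  · exact dotProduct_mulVec_neg_of_smul_eq (by norm_num) (by decide +kernel)
      (by rw [squaresFactor_det]; norm_num) complementGram_smul_eq hv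
  · decide +kernel
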